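/- Let k ≥ 1 and let G and H be finite simple graphs with δ(G) + δ(H) ≥ k. Then γ_{×k,t}(G □ H) ≥ k · ρ(G) · ρ(H). -/

import Mathlib

open SimpleGraph Set

/-- `S` is a `k`-tuple total dominating set (kTDS) of `G`: every vertex of `G`
has at least `k` neighbors in `S`. -/
def IsKTDS {V : Type*} (G : SimpleGraph V) (k : ℕ) (S : Set V) : Prop :=
  ∀ v : V, k ≤ (S ∩ G.neighborSet v).ncard

/-- The `k`-tuple total domination number `γ_{×k,t}(G)`: the minimum cardinality
of a `k`-tuple total dominating set of `G`. -/
noncomputable def kTotalDomNum {V : Type*} [Fintype V] (G : SimpleGraph V) (k : ℕ) : ℕ :=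
  sInf {n : ℕ | ∃ S : Set V, IsKTDS G k S ∧ S.ncard = n}

/-- A packing of `G`: a set of vertices whose closed neighborhoods are pairwise disjoint. -/
def IsPacking {V : Type*} (G : SimpleGraph V) (S : Set V) : Prop :=
  S.Pairwise fun u v => Disjoint (insert u (G.neighborSet u)) (insert v (G.neighborSet v))

/-- The packing number `ρ(G)`: the maximum cardinality of a packing of `G`. -/
noncomputable def packingNum {V : Type*} [Fintype V] (G : SimpleGraph V) : ℕ :=
  sSup {n : ℕ | ∃ S : Set V, IsPacking G S ∧ S.ncard = n}

/-- An open packing of `G`: a set of vertices whose open neighborhoods are pairwise disjoint. -/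
def IsOpenPacking {V : Type*} (G : SimpleGraph V) (S : Set V) : Prop :=
  S.Pairwise fun u v => Disjoint (G.neighborSet u) (G.neighborSet v)

/-- The open packing number `ρ^open(G)`: the maximum cardinality of an open packing of `G`. -/
noncomputable def openPackingNum {V : Type*} [Fintype V] (G : SimpleGraph V) : ℕ :=
  sSup {n : ℕ | ∃ S : Set V, IsOpenPacking G S ∧ S.ncard = n}

theorem exists_isPacking_ncard_eq_packingNum {V : Type*} [Fintype V] (G : SimpleGraph V) :
    ∃ S : Set V, IsPacking G S ∧ S.ncard = packingNum G := by
  refine Nat.sSup_mem (s := {n : ℕ | ∃ S : Set V, IsPacking G S ∧ S.ncard = n})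
    ⟨0, ∅, Set.pairwise_empty _, Set.ncard_empty _⟩ ⟨Nat.card V, ?_⟩
  rintro n ⟨S, -, rfl⟩
  exact Set.ncard_le_card S

theorem IsPacking.isOpenPacking_boxProd {V W : Type*} {G : SimpleGraph V} {H : SimpleGraph W}
    {A : Set V} {B : Set W} (hA : IsPacking G A) (hB : IsPacking H B) :
    IsOpenPacking (G □ H) (A ×ˢ B) := by
  have closed : ∀ p q : V × W, (G □ H).Adj p q →
      q.1 ∈ insert p.1 (G.neighborSet p.1) ∧ q.2 ∈ insert p.2 (H.neighborSet p.2) := by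
    intro p q h
    rcases SimpleGraph.boxProd_adj.1 h with ⟨h, e⟩ | ⟨h, e⟩
    · exact ⟨Or.inr h, Or.inl e.symm⟩
    · exact ⟨Or.inl e.symm, Or.inr h⟩
  rintro p ⟨hpA, hpB⟩ q ⟨hqA, hqB⟩ hpq
  refine Set.disjoint_left.2 fun x hxp hxq => ?_
  obtain ⟨hp₁, hp₂⟩ := closed p x hxp
  obtain ⟨hq₁, hq₂⟩ := closed q x hxq
  by_cases h : p.1 = q.1
  · exact Set.disjoint_left.1 (hB hpB hqB fun h' => hpq (Prod.ext h h')) hp₂ hq₂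
  · exact Set.disjoint_left.1 (hA hpA hqA h) hp₁ hq₁

theorem IsOpenPacking.mul_ncard_le {V : Type*} [Finite V] {G : SimpleGraph V} {k : ℕ}
    {P S : Set V} (hP : IsOpenPacking G P) (hS : IsKTDS G k S) : k * P.ncard ≤ S.ncard := by
  classical
  have := Fintype.ofFinite V
  have hdisj : (P.toFinset : Set V).PairwiseDisjoint
      fun v => (S ∩ G.neighborSet v).toFinset := by
    intro u hu v hv huv
    rw [Function.onFun, Set.disjoint_toFinset]
    exact (hP (by simpa using hu) (by simpa using hv) huv).mono
      Set.inter_subset_right Set.inter_subset_right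
  calc k * P.ncard = ∑ _v ∈ P.toFinset, k := by
        rw [Finset.sum_const, smul_eq_mul, Set.ncard_eq_toFinset_card', mul_comm]
    _ ≤ ∑ v ∈ P.toFinset, (S ∩ G.neighborSet v).toFinset.card :=
        Finset.sum_le_sum fun v _ => by
          rw [← Set.ncard_eq_toFinset_card']
          exact hS v
    _ = (P.toFinset.biUnion fun v => (S ∩ G.neighborSet v).toFinset).card :=
        (Finset.card_biUnion hdisj).symm
    _ ≤ S.toFinset.card := Finset.card_le_card <| Finset.biUnion_subset.2 fun v _ =>
        Set.toFinset_subset_toFinset.2 Set.inter_subset_left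
    _ = S.ncard := (Set.ncard_eq_toFinset_card' S).symm

theorem ncard_neighborSet_boxProd {V W : Type*} [Finite V] [Finite W]
    (G : SimpleGraph V) (H : SimpleGraph W) (p : V × W) :
    ((G □ H).neighborSet p).ncard =
      (G.neighborSet p.1).ncard + (H.neighborSet p.2).ncard := by
  rw [SimpleGraph.neighborSet_boxProd, Set.ncard_union_eq, Set.ncard_prod, Set.ncard_prod,
    Set.ncard_singleton, Set.ncard_singleton, mul_one, one_mul]
  refine Set.disjoint_left.2 ?_
  rintro x ⟨hx, -⟩ ⟨hx', -⟩
  exact G.ne_of_adj hx (Set.mem_singleton_iff.1 hx').symm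

theorem ktdn_boxProd_ge_k_mul_packing_mul_packing {V W : Type*} [Fintype V] [Fintype W]
    (G : SimpleGraph V) (H : SimpleGraph W) (k : ℕ) (hk : 1 ≤ k)
    (hδ : ∀ (u : V) (w : W), k ≤ (G.neighborSet u).ncard + (H.neighborSet w).ncard) :
    k * packingNum G * packingNum H ≤ kTotalDomNum (G □ H) k := by
  obtain ⟨A, hA, hAcard⟩ := exists_isPacking_ncard_eq_packingNum G
  obtain ⟨B, hB, hBcard⟩ := exists_isPacking_ncard_eq_packingNum H
  have huniv : IsKTDS (G □ H) k Set.univ := fun p => by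
    rw [Set.univ_inter, ncard_neighborSet_boxProd]
    exact hδ p.1 p.2
  obtain ⟨S, hS, hScard⟩ := Nat.sInf_mem
    (s := {n : ℕ | ∃ S : Set (V × W), IsKTDS (G □ H) k S ∧ S.ncard = n}) ⟨_, _, huniv, rfl⟩
  rw [kTotalDomNum, ← hScard, ← hAcard, ← hBcard, mul_assoc, ← Set.ncard_prod]
  exact (hA.isOpenPacking_boxProd hB).mul_ncard_le hS
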